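/- Let X be a quasi-median graph and let Γ be either the contact graph CX or the crossing graph ΔX of X. Let A and B be hyperplanes of X lying in the same connected component of Γ, and let p be a vertex of the carrier N(A) and q a vertex of the carrier N(B). Then there exist a geodesic A = A_0, A_1, …, A_m = B in Γ and vertices p = p_0, p_1, …, p_{m+1} = q of X such that p_i ∈ N(A_{i−1}) ∩ N(A_i) for all 1 ≤ i ≤ m, and d_X(p,q) = Σ_{i=0}^{m} d_X(p_i, p_{i+1}). -/

import Mathlib

namespace QM

variable {V : Type*}

/-- `y₁` and `y₂` lie (in this order) on a common geodesic from `x₁` to `x₂`. -/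
def OnGeod (X : SimpleGraph V) (x₁ y₁ y₂ x₂ : V) : Prop :=
  X.dist x₁ y₁ + X.dist y₁ y₂ + X.dist y₂ x₂ = X.dist x₁ x₂

/-- `(y₁, y₂, y₃)` is a `k`-quasi-median triple for `(x₁, x₂, x₃)` (without minimality). -/
def IsQMTriple (X : SimpleGraph V) (x₁ x₂ x₃ y₁ y₂ y₃ : V) (k : ℕ) : Prop :=
  OnGeod X x₁ y₁ y₂ x₂ ∧ OnGeod X x₁ y₁ y₃ x₃ ∧ OnGeod X x₂ y₂ y₃ x₃ ∧
    X.dist y₁ y₂ = k ∧ X.dist y₁ y₃ = k ∧ X.dist y₂ y₃ = k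

/-- `y` is a quasi-median of the triple `(x₁, x₂, x₃)`: it is a `k`-quasi-median triple
with `k` as small as possible. -/
def IsQuasiMedianTriple (X : SimpleGraph V) (x₁ x₂ x₃ : V) (y : V × V × V) : Prop :=
  ∃ k : ℕ, IsQMTriple X x₁ x₂ x₃ y.1 y.2.1 y.2.2 k ∧
    ∀ (k' : ℕ) (z₁ z₂ z₃ : V), IsQMTriple X x₁ x₂ x₃ z₁ z₂ z₃ k' → k ≤ k'

/-- The complete multipartite graph `K_{1,1,2}`: the complete graph on four vertices
with the edge between vertices `2` and `3` removed. -/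
def K112 : SimpleGraph (Fin 4) :=
  SimpleGraph.fromRel (fun i j => ¬(i = 2 ∧ j = 3) ∧ ¬(i = 3 ∧ j = 2))

/-- The 1-skeleton of the 3-cube. -/
def cubeGraph : SimpleGraph (Fin 3 → Bool) :=
  SimpleGraph.fromRel (fun x y => ∃! i, x i ≠ y i)

/-- The 6-cycle. -/
def C6 : SimpleGraph (Fin 6) := SimpleGraph.fromRel (fun i j => j = i + 1)

/-- A set of vertices is convex if it contains every vertex lying on a geodesic between
two of its members. -/
def IsConvexSet (X : SimpleGraph V) (S : Set V) : Prop :=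
  ∀ x ∈ S, ∀ y ∈ S, ∀ z : V, X.dist x z + X.dist z y = X.dist x y → z ∈ S

/-- The convex hull of a set of vertices. -/
def convexHullSet (X : SimpleGraph V) (S : Set V) : Set V :=
  ⋂₀ {T : Set V | S ⊆ T ∧ IsConvexSet X T}

/-- A quasi-median graph: a connected graph in which every triple of vertices has a unique
quasi-median, with no induced `K_{1,1,2}`, and in which the convex hull of every isometrically
embedded 6-cycle is isomorphic to the 3-cube. -/
structure IsQuasiMedian (X : SimpleGraph V) : Prop where
  connected : X.Connected
  uniqueQuasiMedian : ∀ x₁ x₂ x₃ : V, ∃! y : V × V × V, IsQuasiMedianTriple X x₁ x₂ x₃ y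
  noK112 : IsEmpty (SimpleGraph.Embedding K112 X)
  hullOfC6IsCube : ∀ f : Fin 6 → V,
    (∀ i j, C6.Adj i j → X.Adj (f i) (f j)) →
    (∀ i j, X.dist (f i) (f j) = C6.dist i j) →
    Nonempty (SimpleGraph.Iso
      (SimpleGraph.induce (convexHullSet X (Set.range f)) X) cubeGraph)

/-- Two edges are two sides of a common triangle, or opposite sides of a common square. -/
def SideRel (X : SimpleGraph V) (e f : Sym2 V) : Prop :=
  (∃ a b c : V, X.Adj a b ∧ X.Adj a c ∧ X.Adj b c ∧ e = s(a, b) ∧ f = s(a, c)) ∨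
  (∃ a b c d : V, X.Adj a b ∧ X.Adj c d ∧ X.Adj a c ∧ X.Adj b d ∧ a ≠ d ∧ b ≠ c ∧
    e = s(a, b) ∧ f = s(c, d))

/-- The equivalence class of an edge under the equivalence relation generated by `SideRel`. -/
def hypClass (X : SimpleGraph V) (e : Sym2 V) : Set (Sym2 V) :=
  {f | Relation.EqvGen (SideRel X) e f}

/-- A hyperplane: the equivalence class of some edge of `X`. -/
def IsHyperplane (X : SimpleGraph V) (H : Set (Sym2 V)) : Prop :=
  ∃ e ∈ X.edgeSet, H = hypClass X e

/-- The type of hyperplanes of `X`. -/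
def Hyperplane (X : SimpleGraph V) := {H : Set (Sym2 V) // IsHyperplane X H}

/-- Edges `e`, `e'` sharing the endpoint `p`, not lying in a common clique, that are
adjacent sides of a square of `X`: their dual hyperplanes intersect at `p`. -/
def IntersectAt (X : SimpleGraph V) (e e' : Sym2 V) (p : V) : Prop :=
  ∃ a b : V, e = s(p, a) ∧ e' = s(p, b) ∧ X.Adj p a ∧ X.Adj p b ∧ a ≠ b ∧ ¬ X.Adj a b ∧
    ∃ q : V, q ≠ p ∧ X.Adj a q ∧ X.Adj b q

/-- Edges `e`, `e'` sharing the endpoint `p`, not lying in a common clique, and not adjacent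
sides of any square of `X`: their dual hyperplanes osculate at `p`. -/
def OsculateAt (X : SimpleGraph V) (e e' : Sym2 V) (p : V) : Prop :=
  ∃ a b : V, e = s(p, a) ∧ e' = s(p, b) ∧ X.Adj p a ∧ X.Adj p b ∧ a ≠ b ∧ ¬ X.Adj a b ∧
    ¬ ∃ q : V, q ≠ p ∧ X.Adj a q ∧ X.Adj b q

/-- Hyperplanes `H` and `H'` intersect at `p`. -/
def HypIntersectAt (X : SimpleGraph V) (H H' : Hyperplane X) (p : V) : Prop :=
  ∃ e ∈ H.1, ∃ e' ∈ H'.1, IntersectAt X e e' p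

/-- Hyperplanes `H` and `H'` osculate at `p`. -/
def HypOsculateAt (X : SimpleGraph V) (H H' : Hyperplane X) (p : V) : Prop :=
  ∃ e ∈ H.1, ∃ e' ∈ H'.1, OsculateAt X e e' p

/-- Hyperplanes `H` and `H'` intersect. -/
def HypIntersect (X : SimpleGraph V) (H H' : Hyperplane X) : Prop :=
  ∃ p : V, HypIntersectAt X H H' p

/-- Hyperplanes `H` and `H'` osculate. -/
def HypOsculate (X : SimpleGraph V) (H H' : Hyperplane X) : Prop :=
  ∃ p : V, HypOsculateAt X H H' p

/-- The contact graph `𝒞X`: hyperplanes are adjacent iff they intersect or osculate. -/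
def contactGraph (X : SimpleGraph V) : SimpleGraph (Hyperplane X) :=
  SimpleGraph.fromRel (fun H H' => HypIntersect X H H' ∨ HypOsculate X H H')

/-- The crossing graph `ΔX`: hyperplanes are adjacent iff they intersect. -/
def crossingGraph (X : SimpleGraph V) : SimpleGraph (Hyperplane X) :=
  SimpleGraph.fromRel (fun H H' => HypIntersect X H H')

/-- The (vertex set of the) carrier of a hyperplane: all endpoints of its edges. -/
def hypCarrier (X : SimpleGraph V) (H : Hyperplane X) : Set V :=
  {v : V | ∃ e ∈ H.1, v ∈ e}

/-- A set of edges `H` (e.g. a hyperplane) separates `p` from `q` if every walk from `p`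
to `q` uses an edge of `H`. -/
def Separates (X : SimpleGraph V) (H : Set (Sym2 V)) (p q : V) : Prop :=
  ∀ w : X.Walk p q, ∃ e ∈ w.edges, e ∈ H

/-- `f` is a `(λ, c)`-quasi-isometry from `(A, dA)` to `(B, dB)`. -/
def IsQuasiIsometry {A B : Type*} (lam c : ℝ) (dA : A → A → ℝ) (dB : B → B → ℝ)
    (f : A → B) : Prop :=
  (∀ x y : A, dA x y / lam - c ≤ dB (f x) (f y) ∧ dB (f x) (f y) ≤ lam * dA x y + c) ∧
    ∀ b : B, ∃ a : A, dB (f a) b ≤ c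

end QM

namespace QM

section Weak

variable {V : Type*} {X : SimpleGraph V}

theorem dist_le_dist_add_one (hc : X.Connected) {a b : V} (h : X.Adj a b) (x : V) :
    X.dist x b ≤ X.dist x a + 1 := by
  have := hc.dist_triangle (u := x) (v := a) (w := b)
  rwa [SimpleGraph.dist_eq_one_iff_adj.2 h] at this

theorem exists_adj_dist_add_one (hc : X.Connected) {x y : V} (h : x ≠ y) :
    ∃ z, X.Adj x z ∧ X.dist z y + 1 = X.dist x y := by
  obtain ⟨w, hw⟩ := hc.exists_walk_length_eq_dist x y
  cases w with
  | nil => exact absurd rfl h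
  | cons hz w' =>
    rename_i z
    refine ⟨z, hz, ?_⟩
    have h1 := SimpleGraph.dist_le w'
    have h2 := dist_le_dist_add_one hc hz.symm y
    rw [SimpleGraph.dist_comm (u := y), SimpleGraph.dist_comm (u := y)] at h2
    rw [SimpleGraph.Walk.length_cons] at hw
    omega

theorem dist_eq_two (hc : X.Connected) {a b c : V} (hne : a ≠ b) (hab : ¬ X.Adj a b)
    (ha : X.Adj c a) (hb : X.Adj c b) : X.dist a b = 2 := by
  have h1 := dist_le_dist_add_one hc hb a
  have h2 := SimpleGraph.dist_eq_one_iff_adj.2 ha.symm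
  have h3 : X.dist a b ≠ 1 := fun h => hab (SimpleGraph.dist_eq_one_iff_adj.1 h)
  have h4 : X.dist a b ≠ 0 := fun h => hne (hc.dist_eq_zero_iff.1 h)
  omega

/-- The distance function of the 6-cycle. -/
def c6dist (i j : Fin 6) : ℕ := min (i - j).val (j - i).val

theorem dist_C6 (i j : Fin 6) : C6.dist i j = c6dist i j := by
  have hadj : ∀ a b : Fin 6, C6.Adj a b ↔ c6dist a b = 1 := by
    intro a b
    simp only [C6, SimpleGraph.fromRel_adj]
    revert a b
    decide
  have hle : ∀ n i j, c6dist i j = n → ∃ w : C6.Walk i j, w.length = n := by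
    intro n
    induction n with
    | zero =>
      intro i j h
      have : i = j := by revert i j; decide
      subst this
      exact ⟨.nil, rfl⟩
    | succ n ih =>
      intro i j h
      have : ∃ k, c6dist i k = 1 ∧ c6dist k j + 1 = c6dist i j := by
        have : c6dist i j ≠ 0 := by omega
        clear h ih
        revert i j
        decide
      obtain ⟨k, hk, hkj⟩ := this
      obtain ⟨w, hw⟩ := ih k j (by omega)
      exact ⟨.cons ((hadj i k).2 hk) w, by simp [hw]⟩
  have hge : ∀ i j (w : C6.Walk i j), c6dist i j ≤ w.length := by
    intro i j w
    induction w with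
    | nil => rename_i u; revert u; decide
    | cons h w ih =>
      rename_i u v t
      have h1 := (hadj _ _).1 h
      have : c6dist u t ≤ c6dist v t + 1 := by
        clear ih w h
        revert u v t
        decide
      rw [SimpleGraph.Walk.length_cons]
      omega
  obtain ⟨w, hw⟩ := hle _ i j rfl
  obtain ⟨w', hw'⟩ := (SimpleGraph.Walk.reachable w).exists_walk_length_eq_dist
  have h1 := SimpleGraph.dist_le w
  have h2 := hge i j w'
  omega

theorem cubeGraph_adj (x y : Fin 3 → Bool) : cubeGraph.Adj x y ↔
    (x 0 ^^ y 0).toNat + (x 1 ^^ y 1).toNat + (x 2 ^^ y 2).toNat = 1 := by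
  have : ∀ x y : Fin 3 → Bool, (x ≠ y ∧ ((∃! i, x i ≠ y i) ∨ ∃! i, y i ≠ x i)) ↔
      (x 0 ^^ y 0).toNat + (x 1 ^^ y 1).toNat + (x 2 ^^ y 2).toNat = 1 := by
    unfold ExistsUnique
    decide
  rw [← this, cubeGraph, SimpleGraph.fromRel_adj]

theorem cubeGraph_exists_common_neighbor (u v w : Fin 3 → Bool)
    (huv : u ≠ v) (huw : u ≠ w) (hvw : v ≠ w)
    (h1 : ∃ a, cubeGraph.Adj u a ∧ cubeGraph.Adj v a)
    (h2 : ∃ a, cubeGraph.Adj u a ∧ cubeGraph.Adj w a)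
    (h3 : ∃ a, cubeGraph.Adj v a ∧ cubeGraph.Adj w a) :
    ∃ a, cubeGraph.Adj u a ∧ cubeGraph.Adj v a ∧ cubeGraph.Adj w a := by
  have two : ∀ x y : Fin 3 → Bool, x ≠ y → (∃ a, cubeGraph.Adj x a ∧ cubeGraph.Adj y a) →
      (x 0 ^^ y 0).toNat + (x 1 ^^ y 1).toNat + (x 2 ^^ y 2).toNat = 2 := by
    simp only [cubeGraph_adj]
    decide
  replace h1 := two u v huv h1
  replace h2 := two u w huw h2
  replace h3 := two v w hvw h3
  refine ⟨fun i => (u i && v i) || (u i && w i) || (v i && w i), ?_⟩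
  simp only [cubeGraph_adj]
  clear huv huw hvw two
  generalize u 0 = u0, u 1 = u1, u 2 = u2, v 0 = v0, v 1 = v1, v 2 = v2,
    w 0 = w0, w 1 = w1, w 2 = w2 at *
  revert u0 u1 u2 v0 v1 v2 w0 w1 w2
  decide
theorem IsQuasiMedian.adj_of_common_edge (hX : IsQuasiMedian X) {a b u v : V} (hab : X.Adj a b)
    (hau : X.Adj a u) (hbu : X.Adj b u) (hav : X.Adj a v) (hbv : X.Adj b v) (huv : u ≠ v) :
    X.Adj u v := by
  by_contra h
  have hadj : ∀ i j, X.Adj (![a, b, u, v] i) (![a, b, u, v] j) ↔ K112.Adj i j := by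
    have h' : ¬ X.Adj v u := fun h' => h h'.symm
    intro i j
    fin_cases i <;> fin_cases j <;>
      simp [K112, hab, hau, hbu, hav, hbv, h, h', hab.symm, hau.symm, hbu.symm, hav.symm, hbv.symm]
  refine hX.noK112.false ⟨⟨![a, b, u, v], ?_⟩, @fun i j => hadj i j⟩
  intro i j hij
  have n1 := hab.ne
  have n2 := hau.ne
  have n3 := hbu.ne
  have n4 := hav.ne
  have n5 := hbv.ne
  fin_cases i <;> fin_cases j <;> simp_all

theorem IsQuasiMedian.no_K23 (hX : IsQuasiMedian X) {a b u v w : V} (hab : a ≠ b)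
    (hn : ¬ X.Adj a b) (hau : X.Adj a u) (hbu : X.Adj b u) (hav : X.Adj a v) (hbv : X.Adj b v)
    (haw : X.Adj a w) (hbw : X.Adj b w) (huv : u ≠ v) (huw : u ≠ w) (hvw : v ≠ w) : False := by
  have hc := hX.connected
  have key : ∀ {s t}, X.Adj a s → X.Adj b s → X.Adj a t → X.Adj b t → s ≠ t →
      X.dist s t = 2 := by
    intro s t h1 h2 h3 h4 h5
    exact dist_eq_two hc h5
      (fun h => hn (hX.adj_of_common_edge h h1.symm h3.symm h2.symm h4.symm hab)) h1 h3
  have qm : ∀ c, X.Adj c u → X.Adj c v → X.Adj c w → IsQuasiMedianTriple X u v w (c, c, c) := by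
    intro c h1 h2 h3
    refine ⟨0, ?_, fun _ _ _ _ _ => Nat.zero_le _⟩
    simp [IsQMTriple, OnGeod, key hau hbu hav hbv huv, key hau hbu haw hbw huw,
      key hav hbv haw hbw hvw, SimpleGraph.dist_eq_one_iff_adj.2 h1.symm,
      SimpleGraph.dist_eq_one_iff_adj.2 h2, SimpleGraph.dist_eq_one_iff_adj.2 h3,
      SimpleGraph.dist_eq_one_iff_adj.2 h2.symm]
  have := (hX.uniqueQuasiMedian u v w).unique (qm a hau hav haw) (qm b hbu hbv hbw)
  exact hab (Prod.ext_iff.1 this).1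

theorem IsQuasiMedian.exists_qmTriple (hX : IsQuasiMedian X) (x₁ x₂ x₃ : V) :
    ∃ y₁ y₂ y₃ k, IsQMTriple X x₁ x₂ x₃ y₁ y₂ y₃ k := by
  obtain ⟨y, ⟨k, hk, -⟩, -⟩ := hX.uniqueQuasiMedian x₁ x₂ x₃
  exact ⟨_, _, _, k, hk⟩

/-- The triangle condition. -/
theorem IsQuasiMedian.triangle (hX : IsQuasiMedian X) {x a b : V} (hab : X.Adj a b)
    (h : X.dist x a = X.dist x b) :
    ∃ c, X.Adj a c ∧ X.Adj b c ∧ X.dist x c + 1 = X.dist x a := by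
  have hc := hX.connected
  obtain ⟨y, s, t, k, ⟨h1, h2, h3, h4, h5, h6⟩⟩ := hX.exists_qmTriple x a b
  have e1 := SimpleGraph.dist_eq_one_iff_adj.2 hab
  simp only [OnGeod] at h1 h2 h3
  rw [SimpleGraph.dist_comm (u := s) (v := a)] at h1
  by_cases hk : k = 0
  · have : y = s := hc.dist_eq_zero_iff.1 (by omega)
    subst this
    have : y = t := hc.dist_eq_zero_iff.1 (by omega)
    subst this
    omega
  · have : a = s := hc.dist_eq_zero_iff.1 (by omega)
    subst this
    have : t = b := hc.dist_eq_zero_iff.1 (by omega)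
    subst this
    exact ⟨y, (SimpleGraph.dist_eq_one_iff_adj.1 (by omega)).symm,
      (SimpleGraph.dist_eq_one_iff_adj.1 (by omega)).symm, by omega⟩

theorem IsQuasiMedian.exists_common_neighbor_of_hexagon (hX : IsQuasiMedian X) {z v s y t w : V}
    (h1 : X.Adj z v) (h2 : X.Adj v s) (h3 : X.Adj s y) (h4 : X.Adj y t) (h5 : X.Adj t w)
    (h6 : X.Adj w z) (hzy : X.dist z y = 3) (hvt : X.dist v t = 3) (hsw : X.dist s w = 3) :
    ∃ c, X.Adj v c ∧ X.Adj w c ∧ X.Adj y c := by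
  have hc := hX.connected
  have two : ∀ {a b c d}, X.Adj a b → X.Adj b c → X.Adj c d → X.dist a d = 3 →
      X.dist a c = 2 := by
    intro a b c d hab hbc hcd had
    have t1 := dist_le_dist_add_one hc hcd a
    have t2 := dist_le_dist_add_one hc hbc a
    have t3 := SimpleGraph.dist_eq_one_iff_adj.2 hab
    omega
  have hyz : X.dist y z = 3 := by rw [SimpleGraph.dist_comm, hzy]
  have htv : X.dist t v = 3 := by rw [SimpleGraph.dist_comm, hvt]
  have hws : X.dist w s = 3 := by rw [SimpleGraph.dist_comm, hsw]
  have zs := two h1 h2 h3 hzy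
  have vy := two h2 h3 h4 hvt
  have st := two h3 h4 h5 hsw
  have yw := two h4 h5 h6 hyz
  have tz := two h5 h6 h1 htv
  have wv := two h6 h1 h2 hws
  have one : ∀ {a b}, X.Adj a b → X.dist a b = 1 := SimpleGraph.dist_eq_one_iff_adj.2
  let f : Fin 6 → V := ![z, v, s, y, t, w]
  have hdist : ∀ i j, X.dist (f i) (f j) = C6.dist i j := by
    intro i j
    rw [dist_C6]
    fin_cases i <;> fin_cases j <;>
      simp [f, c6dist, hyz, htv, hws, hzy, hvt, hsw, zs, vy, st, yw, tz, wv,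
        SimpleGraph.dist_comm.trans zs, SimpleGraph.dist_comm.trans vy,
        SimpleGraph.dist_comm.trans st, SimpleGraph.dist_comm.trans yw,
        SimpleGraph.dist_comm.trans tz, SimpleGraph.dist_comm.trans wv,
        one h1, one h2, one h3, one h4, one h5, one h6, one h1.symm, one h2.symm, one h3.symm,
        one h4.symm, one h5.symm, one h6.symm] <;> decide
  have hadj : ∀ i j, C6.Adj i j → X.Adj (f i) (f j) := by
    intro i j h
    rw [← SimpleGraph.dist_eq_one_iff_adj, hdist, SimpleGraph.dist_eq_one_iff_adj]
    exact h
  obtain ⟨φ⟩ := hX.hullOfC6IsCube f hadj hdist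
  have hmem : ∀ i, f i ∈ convexHullSet X (Set.range f) :=
    fun i T hT => hT.1 ⟨i, rfl⟩
  let g : Fin 6 → convexHullSet X (Set.range f) := fun i => ⟨f i, hmem i⟩
  have gadj : ∀ i j, X.Adj (f i) (f j) → cubeGraph.Adj (φ (g i)) (φ (g j)) :=
    fun i j h => φ.map_adj_iff.2 h
  have gne : ∀ i j, X.dist (f i) (f j) = 2 → φ (g i) ≠ φ (g j) := by
    intro i j h hij
    have : f i = f j := congrArg Subtype.val (φ.injective hij)
    rw [this, SimpleGraph.dist_self] at h
    omega
  obtain ⟨c, c1, c2, c3⟩ := cubeGraph_exists_common_neighbor (φ (g 1)) (φ (g 5)) (φ (g 3))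
    (gne 1 5 (SimpleGraph.dist_comm.trans wv)) (gne 1 3 vy) (gne 5 3 (SimpleGraph.dist_comm.trans yw))
    ⟨φ (g 0), gadj 1 0 h1.symm, gadj 5 0 h6⟩
    ⟨φ (g 2), gadj 1 2 h2, gadj 3 2 h3.symm⟩
    ⟨φ (g 4), gadj 5 4 h5.symm, gadj 3 4 h4⟩
  have hback : ∀ i, cubeGraph.Adj (φ (g i)) c → X.Adj (f i) (φ.symm c).1 := by
    intro i h
    have : cubeGraph.Adj (φ (g i)) (φ (φ.symm c)) := by rwa [φ.apply_symm_apply]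
    exact φ.map_adj_iff.1 this
  exact ⟨_, hback 1 c1, hback 5 c2, hback 3 c3⟩

end Weak

section Quad

variable {V : Type*} {X : SimpleGraph V}

/-- The quadrangle condition. -/
theorem IsQuasiMedian.quadrangle (hX : IsQuasiMedian X) {x z a b : V} (hza : X.Adj z a)
    (hzb : X.Adj z b) (hab : a ≠ b) (ha : X.dist x a + 1 = X.dist x z)
    (hb : X.dist x b + 1 = X.dist x z) :
    ∃ c, X.Adj a c ∧ X.Adj b c ∧ X.dist x c + 1 = X.dist x a := by
  have hc := hX.connected
  have adj : ∀ {u v}, X.dist u v = 1 → X.Adj u v := SimpleGraph.dist_eq_one_iff_adj.1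
  have one : ∀ {u v}, X.Adj u v → X.dist u v = 1 := SimpleGraph.dist_eq_one_iff_adj.2
  by_cases hadj : X.Adj a b
  · exact hX.triangle hadj (by omega)
  have h2 := dist_eq_two hc hab hadj hza hzb
  by_contra! H
  obtain ⟨y, v, w, k, ⟨e1, e2, e3, f1, f2, f3⟩⟩ := hX.exists_qmTriple x a b
  simp only [OnGeod] at e1 e2 e3
  rw [SimpleGraph.dist_comm (u := v)] at e1
  have zero : ∀ {u v}, X.dist u v = 0 → u = v := hc.dist_eq_zero_iff.1
  have hk : k = 0 ∨ k = 1 ∨ k = 2 := by omega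
  rcases hk with rfl | rfl | rfl
  · obtain rfl := zero f1
    obtain rfl := zero f2
    have n1 : X.dist a y = 1 := by
      have : X.dist y b = X.dist b y := SimpleGraph.dist_comm
      omega
    exact H y (adj n1) (adj (by rw [SimpleGraph.dist_comm]; omega)) (by omega)
  · omega
  · obtain rfl : a = v := zero (by omega)
    obtain rfl : w = b := zero (by omega)
    have hxy : X.dist x y + 2 = X.dist x a := by omega
    have hzy : X.dist z y = 3 := by
      have t1 := hc.dist_triangle (u := x) (v := y) (w := z)
      have t2 := dist_le_dist_add_one hc hza.symm y
      rw [SimpleGraph.dist_comm (u := y) (v := z)] at t1 t2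
      omega
    have H' : ∀ c, X.Adj y c → X.Adj a c → ¬ X.Adj w c := by
      intro c h1 h2 h3
      have t1 := dist_le_dist_add_one hc h1 x
      have t2 := dist_le_dist_add_one hc h2.symm x
      exact H c h2 h3 (by omega)
    have step : ∀ {u}, X.Adj z u → X.dist y u = 2 → ∃ s, X.Adj u s ∧ X.Adj s y := by
      intro u hu hyu
      have : u ≠ y := by
        rintro rfl
        simp at hyu
      obtain ⟨s, hs, hsy⟩ := exists_adj_dist_add_one hc this
      exact ⟨s, hs, adj (by rw [SimpleGraph.dist_comm (u := u)] at hsy; omega)⟩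
    have nst : ∀ {s t}, X.Adj a s → X.Adj s y → X.Adj w t → X.Adj t y → ¬ X.Adj s t := by
      intro s t has hsy hwt hty hst
      have z1 := dist_le_dist_add_one hc has z
      have z2 := dist_le_dist_add_one hc hwt z
      have z3 := dist_le_dist_add_one hc hsy z
      have z4 := dist_le_dist_add_one hc hty z
      rw [one hza] at z1
      rw [one hzb] at z2
      obtain ⟨c, hsc, htc, hzc⟩ := hX.triangle hst (x := z) (by omega)
      have hne : c ≠ y := by
        rintro rfl
        omega
      have z5 := dist_le_dist_add_one hc (hX.adj_of_common_edge hst hsc htc hsy hty hne) z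
      omega
    obtain ⟨s, has, hsy⟩ := step hza f1
    obtain ⟨t, hwt, hty⟩ := step hzb f2
    have hws : X.dist w s = 3 := by
      have t1 := dist_le_dist_add_one hc hsy.symm w
      rw [SimpleGraph.dist_comm (u := w) (v := y)] at t1
      have t2 : X.dist w s ≠ 1 := fun h => H' s hsy.symm has (adj h)
      have t3 : X.dist w s ≠ 0 := by
        intro h
        obtain rfl := zero h
        exact hadj has
      have t4 : X.dist w s ≠ 2 := by
        intro h
        obtain ⟨c, h1, h2, h3⟩ := hX.triangle hsy (x := w)
          (by rw [SimpleGraph.dist_comm (v := y)]; omega)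
        exact nst has hsy (adj (by omega)) h2.symm h1
      omega
    have hat : X.dist a t = 3 := by
      have t1 := dist_le_dist_add_one hc hty.symm a
      rw [SimpleGraph.dist_comm (u := a) (v := y)] at t1
      have t2 : X.dist a t ≠ 1 := fun h => H' t hty.symm (adj h) hwt
      have t3 : X.dist a t ≠ 0 := by
        intro h
        obtain rfl := zero h
        exact hadj hwt.symm
      have t4 : X.dist a t ≠ 2 := by
        intro h
        obtain ⟨c, h1, h2, h3⟩ := hX.triangle hty (x := a)
          (by rw [SimpleGraph.dist_comm (v := y)]; omega)
        exact nst (adj (by omega)) h2.symm hwt hty h1.symm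
      omega
    obtain ⟨c, c1, c2, c3⟩ := hX.exists_common_neighbor_of_hexagon hza has hsy hty.symm hwt.symm
      hzb.symm hzy hat (by rw [SimpleGraph.dist_comm]; exact hws)
    exact H' c c3 c1 c2

theorem IsQuasiMedian.exists_adj_dist_lt (hX : IsQuasiMedian X) {x a y : V}
    (h : X.dist x y < X.dist x a) :
    ∃ z, X.Adj a z ∧ X.dist z y + 1 = X.dist a y ∧ X.dist x z + 1 = X.dist x a := by
  have hc := hX.connected
  obtain ⟨u, v, w, k, ⟨e1, e2, e3, f1, f2, f3⟩⟩ := hX.exists_qmTriple x a y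
  simp only [OnGeod] at e1 e2 e3
  have hv : a ≠ v := by
    rintro rfl
    simp only [SimpleGraph.dist_self] at *
    omega
  obtain ⟨z, hz, hzv⟩ := exists_adj_dist_add_one hc hv
  refine ⟨z, hz, ?_⟩
  have t1 := hc.dist_triangle (u := z) (v := v) (w := y)
  have t2 := hc.dist_triangle (u := v) (v := w) (w := y)
  have t3 := hc.dist_triangle (u := x) (v := v) (w := z)
  have t4 := hc.dist_triangle (u := x) (v := u) (w := v)
  have t5 := dist_le_dist_add_one hc hz.symm x
  have t6 := dist_le_dist_add_one hc hz.symm y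
  rw [SimpleGraph.dist_comm (u := y), SimpleGraph.dist_comm (u := y)] at t6
  rw [SimpleGraph.dist_comm (u := v) (v := z)] at t3
  rw [SimpleGraph.dist_comm (u := v) (v := a)] at e1
  omega

/-- If `a` is not between `x` and `s`, there are neighbours of `a` towards `x` and towards `s`
which are equal or adjacent. -/
theorem IsQuasiMedian.exists_corner (hX : IsQuasiMedian X) {x a s : V}
    (h : X.dist x s ≠ X.dist x a + X.dist a s) :
    ∃ u v, X.Adj a u ∧ X.Adj a v ∧ (u = v ∨ X.Adj u v) ∧
      X.dist x u + 1 = X.dist x a ∧ X.dist v s + 1 = X.dist a s := by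
  have hc := hX.connected
  obtain ⟨p, y, q, k, ⟨e1, e2, e3, f1, f2, f3⟩⟩ := hX.exists_qmTriple x a s
  simp only [OnGeod] at e1 e2 e3
  by_cases hy : a = y
  · subst hy
    simp only [SimpleGraph.dist_self] at *
    have hk : k ≠ 0 := by
      rintro rfl
      omega
    have haq : a ≠ q := by
      rintro rfl
      rw [SimpleGraph.dist_self] at f3
      omega
    obtain ⟨v, hav, hvq⟩ := exists_adj_dist_add_one hc haq
    have near : ∀ {u}, X.dist p u + 1 = X.dist p a → X.Adj a u → X.dist x u + 1 = X.dist x a := by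
      intro u hu hau
      have t1 := hc.dist_triangle (u := x) (v := p) (w := u)
      have t2 := dist_le_dist_add_one hc hau.symm x
      omega
    have near' : ∀ {u}, X.dist u q + 1 = X.dist a q → X.Adj a u →
        X.dist u s + 1 = X.dist a s := by
      intro u hu hau
      have t1 := hc.dist_triangle (u := u) (v := q) (w := s)
      have t2 := dist_le_dist_add_one hc hau.symm s
      rw [SimpleGraph.dist_comm (u := s), SimpleGraph.dist_comm (u := s)] at t2
      omega
    have t1 := dist_le_dist_add_one hc hav p
    have t2 := dist_le_dist_add_one hc hav.symm p
    have hcases : X.dist p v + 1 = X.dist p a ∨ X.dist p v = X.dist p a ∨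
        X.dist p v = X.dist p a + 1 := by omega
    rcases hcases with h1 | h1 | h1
    · exact ⟨v, v, hav, hav, Or.inl rfl, near h1 hav, near' hvq hav⟩
    · obtain ⟨u, hau, hvu, hu⟩ := hX.triangle hav h1.symm
      exact ⟨u, v, hau, hav, Or.inr hvu.symm, near hu hau, near' hvq hav⟩
    · obtain ⟨z, hvz, hzq, hz⟩ := hX.exists_adj_dist_lt (x := p) (a := v) (y := q) (by omega)
      have haz : a ≠ z := by
        rintro rfl
        omega
      obtain ⟨u, hau, hzu, hu⟩ := hX.quadrangle hav.symm hvz haz (x := p) (by omega) (by omega)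
      have t3 := dist_le_dist_add_one hc hzu q
      have t4 := dist_le_dist_add_one hc hau.symm q
      rw [SimpleGraph.dist_comm (v := z), SimpleGraph.dist_comm (v := u)] at t3
      rw [SimpleGraph.dist_comm (v := a), SimpleGraph.dist_comm (v := u)] at t4
      exact ⟨u, u, hau, hau, Or.inl rfl, near hu hau, near' (by omega) hau⟩
  · obtain ⟨z, hz, hzy⟩ := exists_adj_dist_add_one hc hy
    refine ⟨z, z, hz, hz, Or.inl rfl, ?_⟩
    have t1 := hc.dist_triangle (u := z) (v := y) (w := s)
    have t2 := hc.dist_triangle (u := y) (v := q) (w := s)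
    have t3 := hc.dist_triangle (u := x) (v := y) (w := z)
    have t4 := hc.dist_triangle (u := x) (v := p) (w := y)
    have t5 := dist_le_dist_add_one hc hz.symm x
    have t6 := dist_le_dist_add_one hc hz.symm s
    rw [SimpleGraph.dist_comm (u := s), SimpleGraph.dist_comm (u := s)] at t6
    rw [SimpleGraph.dist_comm (u := y) (v := z)] at t3
    rw [SimpleGraph.dist_comm (u := y) (v := a)] at e1
    omega

end Quad

section Sectors

variable {V : Type*} {X : SimpleGraph V}

/-- The vertex `x` is closer to `a` than to `b`, by exactly one. -/
def Toward (X : SimpleGraph V) (a b x : V) : Prop :=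
  X.dist x b = X.dist x a + 1

/-- The oriented edges `(a, b)` and `(x, y)` are opposite sides of a ladder of squares. -/
def Parallel (X : SimpleGraph V) (a b x y : V) : Prop :=
  X.Adj a b ∧ X.Adj x y ∧ X.dist b y = X.dist a x ∧ X.dist a y = X.dist a x + 1 ∧
    X.dist b x = X.dist a x + 1

/-- The vertex `c` lies in the maximal clique containing the edge between `a` and `b`. -/
def InClique (X : SimpleGraph V) (a b c : V) : Prop :=
  (c = a ∨ X.Adj a c) ∧ (c = b ∨ X.Adj b c)

theorem Parallel.symm {a b x y : V} (h : Parallel X a b x y) : Parallel X b a y x := by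
  obtain ⟨h1, h2, h3, h4, h5⟩ := h
  exact ⟨h1.symm, h2.symm, h3.symm, by omega, by omega⟩

theorem Parallel.toward_left {a b x y : V} (h : Parallel X a b x y) : Toward X a b x := by
  obtain ⟨h1, h2, h3, h4, h5⟩ := h
  rw [Toward, SimpleGraph.dist_comm, h5, SimpleGraph.dist_comm]

theorem Parallel.toward_right {a b x y : V} (h : Parallel X a b x y) : Toward X x y a := by
  exact h.2.2.2.1

theorem parallel_of_toward (hc : X.Connected) {a b x y : V} (hab : X.Adj a b) (hxy : X.Adj x y)
    (ha : Toward X x y a) (hb : Toward X y x b) : Parallel X a b x y := by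
  unfold Toward at ha hb
  have t1 := dist_le_dist_add_one hc hab x
  have t2 := dist_le_dist_add_one hc hab.symm y
  rw [SimpleGraph.dist_comm (u := x), SimpleGraph.dist_comm (u := x)] at t1
  rw [SimpleGraph.dist_comm (u := y), SimpleGraph.dist_comm (u := y)] at t2
  exact ⟨hab, hxy, by omega, by omega, by omega⟩

theorem IsQuasiMedian.toward_triangle (hX : IsQuasiMedian X) {a b c x : V} (hab : X.Adj a b)
    (hac : X.Adj a c) (hbc : X.Adj b c) (h : Toward X a b x) : Toward X a c x := by
  have hc := hX.connected
  unfold Toward at *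
  have t1 := dist_le_dist_add_one hc hac x
  have t2 := dist_le_dist_add_one hc hbc.symm x
  by_contra hne
  obtain ⟨e, hae, hce, he⟩ := hX.triangle hac (x := x) (by omega)
  have hbe : b ≠ e := by
    rintro rfl
    omega
  have t3 := dist_le_dist_add_one hc (hX.adj_of_common_edge hac hab hbc.symm hae hce hbe).symm x
  omega

/-- Two squares sharing an edge and spanned by a triangle form a prism. -/
theorem IsQuasiMedian.prism (hX : IsQuasiMedian X) {a b c d u w : V} (hbd : X.Adj b d)
    (hbw : X.Adj b w) (hdw : X.Adj d w) (hab : X.Adj a b) (hac : X.Adj a c) (hcd : X.Adj c d)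
    (hau : X.Adj a u) (huw : X.Adj u w) (had : ¬ X.Adj a d) (haw : ¬ X.Adj a w)
    (hbc : b ≠ c) (hbu : b ≠ u) : X.Adj c u := by
  have hc := hX.connected
  have hwa : w ≠ a := by
    rintro rfl
    exact had hdw.symm
  have hda : d ≠ a := by
    rintro rfl
    exact haw hdw
  have hnbc : ¬ X.Adj b c := fun h => had (hX.adj_of_common_edge h hab.symm hac.symm hbd hcd hda.symm)
  have hwc : w ≠ c := by
    rintro rfl
    exact haw hac
  have hnwc : ¬ X.Adj w c := fun h => hnbc (hX.adj_of_common_edge hdw hbd.symm hbw.symm hcd.symm h hbc)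
  have e1 := dist_eq_two hc hwc hnwc hdw hcd.symm
  have e2 := dist_eq_two hc hwa (fun h => haw h.symm) hbw hab.symm
  obtain ⟨t, hat, hct, ht⟩ := hX.triangle hac (x := w) (by omega)
  have hwt : X.Adj w t := SimpleGraph.dist_eq_one_iff_adj.1 (by omega)
  by_cases htu : t = u
  · exact htu ▸ hct
  · have htb : b ≠ t := by
      rintro rfl
      exact hnbc hct.symm
    exact (hX.no_K23 hwa (fun h => haw h.symm) hbw.symm hab huw.symm hau hwt hat hbu htb
      (Ne.symm htu)).elim

theorem IsQuasiMedian.toward_square (hX : IsQuasiMedian X) {a b c d x : V} (hab : X.Adj a b)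
    (hcd : X.Adj c d) (hac : X.Adj a c) (hbd : X.Adj b d) (had : a ≠ d) (hbc : b ≠ c)
    (hnad : ¬ X.Adj a d) (h : Toward X a b x) : Toward X c d x := by
  have hc := hX.connected
  have hnbc : ¬ X.Adj b c := fun h => hnad (hX.adj_of_common_edge h hab.symm hac.symm hbd hcd had)
  unfold Toward at *
  have t1 := dist_le_dist_add_one hc hac x
  have t2 := dist_le_dist_add_one hc hac.symm x
  have t3 := dist_le_dist_add_one hc hbd x
  have t4 := dist_le_dist_add_one hc hbd.symm x
  have t5 := dist_le_dist_add_one hc hcd x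
  by_contra hne
  by_cases hd : X.dist x d = X.dist x a
  · obtain ⟨u, hau, hdu, hu⟩ := hX.quadrangle hab.symm hbd had (x := x) (by omega) (by omega)
    refine hX.no_K23 had hnad hab hbd.symm hau hdu hac hcd.symm ?_ hbc ?_
    · rintro rfl
      omega
    · rintro rfl
      omega
  · obtain ⟨w, hbw, hdw, hw⟩ := hX.triangle hbd (x := x) (by omega)
    have haw : a ≠ w := by
      rintro rfl
      exact hnad hdw.symm
    have hnaw : ¬ X.Adj a w := by
      intro h
      exact hnad (hX.adj_of_common_edge hbw hab.symm h.symm hbd hdw.symm had)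
    obtain ⟨u, hau, hwu, hu⟩ := hX.quadrangle hab.symm hbw haw (x := x) (by omega) (by omega)
    have hbu : b ≠ u := by
      rintro rfl
      omega
    have := hX.prism hbd hbw hdw hab hac hcd hau hwu.symm hnad hnaw hbc hbu
    have t6 := dist_le_dist_add_one hc this.symm x
    omega

theorem IsQuasiMedian.exists_rung (hX : IsQuasiMedian X) {a b x y a' : V}
    (h : Parallel X a b x y) (ha : X.Adj a a') (ha' : X.dist a' x + 1 = X.dist a x) :
    ∃ b', X.Adj b b' ∧ X.Adj a' b' ∧ a ≠ b' ∧ ¬ X.Adj a b' ∧ b ≠ a' ∧ Parallel X a' b' x y := by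
  have hc := hX.connected
  obtain ⟨h1, h2, h3, h4, h5⟩ := h
  have t1 := dist_le_dist_add_one hc h2 a'
  have t2 := dist_le_dist_add_one hc ha.symm y
  have c1 : X.dist y a' = X.dist a' y := SimpleGraph.dist_comm
  have c2 : X.dist y a = X.dist a y := SimpleGraph.dist_comm
  have c3 : X.dist y b = X.dist b y := SimpleGraph.dist_comm
  have hba : b ≠ a' := by
    rintro rfl
    omega
  obtain ⟨b', hbb', hab', hb'⟩ := hX.quadrangle h1 ha hba (x := y) (by omega) (by omega)
  have c4 : X.dist y b' = X.dist b' y := SimpleGraph.dist_comm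
  have t3 := dist_le_dist_add_one hc h2.symm b'
  have t4 := dist_le_dist_add_one hc hbb'.symm x
  have c5 : X.dist x b' = X.dist b' x := SimpleGraph.dist_comm
  have c6 : X.dist x b = X.dist b x := SimpleGraph.dist_comm
  refine ⟨b', hbb', hab', ?_, ?_, hba, hab', h2, by omega, by omega, by omega⟩
  · rintro rfl
    omega
  · intro h
    have := dist_le_dist_add_one hc h.symm y
    omega

theorem IsQuasiMedian.eqvGen_of_parallel (hX : IsQuasiMedian X) {a b x y : V}
    (h : Parallel X a b x y) : Relation.EqvGen (SideRel X) s(a, b) s(x, y) := by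
  have hc := hX.connected
  induction hn : X.dist a x generalizing a b with
  | zero =>
    obtain rfl := hc.dist_eq_zero_iff.1 hn
    obtain rfl := hc.dist_eq_zero_iff.1 (h.2.2.1.trans hn)
    exact .refl _
  | succ n ih =>
    have hax : a ≠ x := by
      rintro rfl
      simp at hn
    obtain ⟨a', haa', ha'⟩ := exists_adj_dist_add_one hc hax
    obtain ⟨b', hbb', hab', hne, -, hba, hp⟩ := hX.exists_rung h haa' ha'
    exact .trans _ _ _ (.rel _ _ (Or.inr ⟨a, b, a', b', h.1, hab', haa', hbb', hne, hba, rfl, rfl⟩))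
      (ih hp (by omega))

theorem eqvGen_of_triangle {a b c : V} (hab : X.Adj a b) (hac : X.Adj a c) (hbc : X.Adj b c) :
    Relation.EqvGen (SideRel X) s(a, b) s(a, c) :=
  .rel _ _ (Or.inl ⟨a, b, c, hab, hac, hbc, rfl, rfl⟩)

/-- An edge leaving a sector of `(a, b)` is dual to the same hyperplane as `(a, b)`. -/
theorem IsQuasiMedian.eqvGen_of_crossing (hX : IsQuasiMedian X) {a b x y : V} (hab : X.Adj a b)
    (hxy : X.Adj x y) (hx : Toward X a b x) (hy : ¬ Toward X a b y) :
    Relation.EqvGen (SideRel X) s(a, b) s(x, y) := by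
  have hc := hX.connected
  have main : ∀ {b}, X.Adj a b → Toward X a b x → Toward X b a y →
      Relation.EqvGen (SideRel X) s(a, b) s(x, y) := by
    intro b hab hx hy
    have := parallel_of_toward hc hxy hab hx hy
    exact .symm _ _ (hX.eqvGen_of_parallel this)
  by_cases hy' : X.dist y a = X.dist y b
  · obtain ⟨c, hac, hbc, hcd⟩ := hX.triangle hab hy'
    exact .trans _ _ _ (eqvGen_of_triangle hab hac hbc)
      (main hac (hX.toward_triangle hab hac hbc hx) (by unfold Toward; omega))
  · refine main hab hx ?_
    have t1 := dist_le_dist_add_one hc hab y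
    have t2 := dist_le_dist_add_one hc hab.symm y
    unfold Toward at *
    omega

theorem IsQuasiMedian.adj_of_inClique (hX : IsQuasiMedian X) {a b c d : V} (hab : X.Adj a b)
    (hc : InClique X a b c) (hd : InClique X a b d) (hcd : c ≠ d) : X.Adj c d := by
  obtain ⟨rfl | hc1, rfl | hc2⟩ := hc
  · exact absurd rfl hab.ne
  · exact hd.1.resolve_left hcd.symm
  · exact hd.2.resolve_left hcd.symm
  obtain ⟨rfl | hd1, rfl | hd2⟩ := hd
  · exact absurd rfl hab.ne
  · exact hc1.symm
  · exact hc2.symm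
  exact hX.adj_of_common_edge hab hc1 hc2 hd1 hd2 hcd

theorem IsQuasiMedian.inClique_of_adj (hX : IsQuasiMedian X) {a b c d e : V}
    (hc : InClique X a b c) (hd : InClique X a b d) (hcd : X.Adj c d) (hce : X.Adj c e)
    (hde : X.Adj d e) : InClique X a b e := by
  have key : ∀ {a}, (c = a ∨ X.Adj a c) → (d = a ∨ X.Adj a d) → e = a ∨ X.Adj a e := by
    rintro a (rfl | h1) (rfl | h2)
    · exact Or.inr hce
    · exact Or.inr hce
    · exact Or.inr hde
    · by_cases h : e = a
      · exact Or.inl h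
      · exact Or.inr (hX.adj_of_common_edge hcd h1.symm h2.symm hce hde (Ne.symm h))
  exact ⟨key hc.1 hd.1, key hc.2 hd.2⟩

theorem inClique_left {a b : V} (hab : X.Adj a b) : InClique X a b a :=
  ⟨Or.inl rfl, Or.inr hab.symm⟩

theorem inClique_right {a b : V} (hab : X.Adj a b) : InClique X a b b :=
  ⟨Or.inr hab, Or.inl rfl⟩

theorem IsQuasiMedian.eqvGen_of_inClique (hX : IsQuasiMedian X) {a b c d : V} (hab : X.Adj a b)
    (hc : InClique X a b c) (hd : InClique X a b d) (hcd : c ≠ d) :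
    Relation.EqvGen (SideRel X) s(a, b) s(c, d) := by
  have left : ∀ {e}, InClique X a b e → a ≠ e → Relation.EqvGen (SideRel X) s(a, b) s(a, e) := by
    intro e he hae
    by_cases hbe : b = e
    · exact hbe ▸ .refl _
    · exact eqvGen_of_triangle hab (hX.adj_of_inClique hab (inClique_left hab) he hae)
        (hX.adj_of_inClique hab (inClique_right hab) he hbe)
  by_cases hac : a = c
  · subst hac
    exact left hd hcd
  · refine .trans _ _ _ (left hc hac) ?_
    rw [Sym2.eq_swap]
    by_cases had : a = d
    · exact had ▸ .refl _
    · exact eqvGen_of_triangle (hX.adj_of_inClique hab hc (inClique_left hab) (Ne.symm hac))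
        (hX.adj_of_inClique hab hc hd hcd) (hX.adj_of_inClique hab (inClique_left hab) hd had)

/-- The oriented edge `(x, y)` is parallel to an edge of the maximal clique of `(a, b)`. -/
def CliqueParallel (X : SimpleGraph V) (a b x y : V) : Prop :=
  ∃ c d, InClique X a b c ∧ InClique X a b d ∧ Parallel X c d x y

theorem CliqueParallel.symm {a b x y : V} (h : CliqueParallel X a b x y) :
    CliqueParallel X a b y x := by
  obtain ⟨c, d, hc, hd, h⟩ := h
  exact ⟨d, c, hd, hc, h.symm⟩

theorem IsQuasiMedian.cliqueParallel_triangle (hX : IsQuasiMedian X) {a b x y z : V}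
    (h : CliqueParallel X a b x y) (hxz : X.Adj x z) (hyz : X.Adj y z) :
    CliqueParallel X a b x z := by
  obtain ⟨c, d, hc, hd, h⟩ := h
  have hxy := h.2.1
  have h1 : Toward X x z c := hX.toward_triangle hxy hxz hyz h.toward_right
  have h2 : Toward X y z d := hX.toward_triangle hxy.symm hyz hxz h.symm.toward_right
  have h3 := h.toward_left
  have h4 := h.2.2.1
  have c1 : X.dist z c = X.dist c z := SimpleGraph.dist_comm
  have c2 : X.dist z d = X.dist d z := SimpleGraph.dist_comm
  unfold Toward at h1 h2
  obtain ⟨e, hce, hde, he⟩ := hX.triangle h.1 (x := z) (by omega)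
  have h5 : Toward X c e x := hX.toward_triangle h.1 hce hde h3
  refine ⟨c, e, hc, hX.inClique_of_adj hc hd h.1 hce hde, hce, hxz, ?_⟩
  unfold Toward at h5
  have c3 : X.dist z e = X.dist e z := SimpleGraph.dist_comm
  have c4 : X.dist x e = X.dist e x := SimpleGraph.dist_comm
  have c5 : X.dist x c = X.dist c x := SimpleGraph.dist_comm
  omega

theorem IsQuasiMedian.cliqueParallel_square (hX : IsQuasiMedian X) {a b x y x' y' : V}
    (h : CliqueParallel X a b x y) (hxy' : X.Adj x' y') (hx : X.Adj x x') (hy : X.Adj y y')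
    (h1 : x ≠ y') (h2 : y ≠ x') : CliqueParallel X a b x' y' := by
  by_cases had : X.Adj x y'
  · exact (hX.cliqueParallel_triangle (hX.cliqueParallel_triangle h had hy).symm
      hxy'.symm hx).symm
  · obtain ⟨c, d, hc, hd, h⟩ := h
    have had' : ¬ X.Adj y x' := fun h' =>
      had (hX.adj_of_common_edge h' h.2.1.symm hx.symm hy hxy' h1)
    exact ⟨c, d, hc, hd, parallel_of_toward hX.connected h.1 hxy'
      (hX.toward_square h.2.1 hxy' hx hy h1 h2 had h.toward_right)
      (hX.toward_square h.2.1.symm hxy'.symm hy hx h2 h1 had' h.symm.toward_right)⟩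

theorem SideRel.symm {e f : Sym2 V} (h : SideRel X e f) : SideRel X f e := by
  rcases h with ⟨a, b, c, h1, h2, h3, rfl, rfl⟩ | ⟨a, b, c, d, h1, h2, h3, h4, h5, h6, rfl, rfl⟩
  · exact Or.inl ⟨a, c, b, h2, h1, h3.symm, rfl, rfl⟩
  · exact Or.inr ⟨c, d, a, b, h2, h1, h3.symm, h4.symm, h6.symm, h5.symm, rfl, rfl⟩

theorem IsQuasiMedian.cliqueParallel_of_eqvGen (hX : IsQuasiMedian X) {a b x y : V}
    (hab : X.Adj a b) (h : Relation.EqvGen (SideRel X) s(a, b) s(x, y)) :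
    CliqueParallel X a b x y := by
  let R : Sym2 V → Prop := fun f => ∃ x y, f = s(x, y) ∧ CliqueParallel X a b x y
  have oriented : ∀ {x y}, R s(x, y) → CliqueParallel X a b x y := by
    rintro x y ⟨x', y', hf, h⟩
    rcases Sym2.eq_iff.1 hf with ⟨rfl, rfl⟩ | ⟨rfl, rfl⟩
    · exact h
    · exact h.symm
  have step : ∀ {e f}, SideRel X e f → R e → R f := by
    rintro e f (⟨x, y, z, h1, h2, h3, rfl, rfl⟩ | ⟨x, y, x', y', h1, h2, h3, h4, h5, h6, rfl, rfl⟩) h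
    · exact ⟨x, z, rfl, hX.cliqueParallel_triangle (oriented h) h2 h3⟩
    · exact ⟨x', y', rfl, hX.cliqueParallel_square (oriented h) h2 h3 h4 h5 h6⟩
  have key : ∀ {e f}, Relation.EqvGen (SideRel X) e f → (R e ↔ R f) := by
    intro e f h
    induction h with
    | rel _ _ h => exact ⟨step h, step h.symm⟩
    | refl => exact Iff.rfl
    | symm _ _ _ ih => exact ih.symm
    | trans _ _ _ _ _ ih1 ih2 => exact ih1.trans ih2
  refine oriented ((key h).1 ⟨a, b, rfl, a, b, inClique_left hab, inClique_right hab, hab, hab, ?_⟩)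
  have := SimpleGraph.dist_eq_one_iff_adj.2 hab
  simp [this, SimpleGraph.dist_comm.trans this]

/-- If `x` is closest to `c` in the maximal clique of `(a, b)`, then it is farther from all the
other vertices of this clique. -/
theorem IsQuasiMedian.toward_of_inClique (hX : IsQuasiMedian X) {a b c d e x : V}
    (hab : X.Adj a b) (hc : InClique X a b c) (hd : InClique X a b d) (he : InClique X a b e)
    (hcd : c ≠ d) (hce : c ≠ e) (h : Toward X c d x) : Toward X c e x := by
  by_cases hde : d = e
  · exact hde ▸ h
  · exact hX.toward_triangle (hX.adj_of_inClique hab hc hd hcd) (hX.adj_of_inClique hab hc he hce)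
      (hX.adj_of_inClique hab hd he hde) h

/-- No edge of the hyperplane dual to `(a, b)` has both endpoints in the sector of `a`. -/
theorem IsQuasiMedian.not_eqvGen_of_toward (hX : IsQuasiMedian X) {a b x y : V}
    (hab : X.Adj a b) (hx : Toward X a b x) (hy : Toward X a b y) :
    ¬ Relation.EqvGen (SideRel X) s(a, b) s(x, y) := by
  intro h
  obtain ⟨c, d, hc, hd, h⟩ := hX.cliqueParallel_of_eqvGen hab h
  have key : ∀ {c d x}, InClique X a b c → InClique X a b d → c ≠ d → Toward X c d x →
      Toward X a b x → c = a := by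
    intro c d x hc hd hcd h hx
    by_contra hca
    have h1 := hX.toward_of_inClique hab hc hd (inClique_left hab) hcd hca h
    have h2 := hX.toward_of_inClique hab (inClique_left hab) (inClique_right hab) hc hab.ne
      (Ne.symm hca) hx
    unfold Toward at h1 h2
    omega
  exact h.1.ne ((key hc hd h.1.ne h.toward_left hx).trans
    (key hd hc h.1.ne.symm h.symm.toward_left hy).symm)

end Sectors

section Carriers

variable {V : Type*} {X : SimpleGraph V}

theorem mem_edgeSet_iff_of_eqvGen {e f : Sym2 V} (h : Relation.EqvGen (SideRel X) e f) :
    e ∈ X.edgeSet ↔ f ∈ X.edgeSet := by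
  induction h with
  | rel _ _ h =>
    rcases h with ⟨a, b, c, h1, h2, h3, rfl, rfl⟩ | ⟨a, b, c, d, h1, h2, h3, h4, h5, h6, rfl, rfl⟩
    · simp [h1, h2]
    · simp [h1, h2]
  | refl => exact Iff.rfl
  | symm _ _ _ ih => exact ih.symm
  | trans _ _ _ _ _ ih1 ih2 => exact ih1.trans ih2

theorem Hyperplane.eqvGen {H : Hyperplane X} {e f : Sym2 V} (he : e ∈ H.1) (hf : f ∈ H.1) :
    Relation.EqvGen (SideRel X) e f := by
  obtain ⟨e₀, -, hH⟩ := H.2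
  rw [hH] at he hf
  exact .trans _ _ _ (.symm _ _ he) hf

theorem Hyperplane.mem_of_eqvGen {H : Hyperplane X} {e f : Sym2 V} (he : e ∈ H.1)
    (h : Relation.EqvGen (SideRel X) e f) : f ∈ H.1 := by
  obtain ⟨e₀, -, hH⟩ := H.2
  rw [hH] at he ⊢
  exact .trans _ _ _ he h

theorem Hyperplane.mem_edgeSet {H : Hyperplane X} {e : Sym2 V} (he : e ∈ H.1) :
    e ∈ X.edgeSet := by
  obtain ⟨e₀, h₀, hH⟩ := H.2
  rw [hH] at he
  exact (mem_edgeSet_iff_of_eqvGen he).1 h₀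

theorem Hyperplane.eq_of_mem {H K : Hyperplane X} {e : Sym2 V} (hH : e ∈ H.1) (hK : e ∈ K.1) :
    H = K :=
  Subtype.ext (Set.ext fun _ => ⟨fun hf => K.mem_of_eqvGen hK (H.eqvGen hH hf),
    fun hf => H.mem_of_eqvGen hH (K.eqvGen hK hf)⟩)

theorem exists_hyperplane {a b : V} (hab : X.Adj a b) : ∃ H : Hyperplane X, s(a, b) ∈ H.1 :=
  ⟨⟨hypClass X s(a, b), s(a, b), hab, rfl⟩, Relation.EqvGen.refl _⟩

theorem mem_hypCarrier_iff {H : Hyperplane X} {v : V} :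
    v ∈ hypCarrier X H ↔ ∃ w, X.Adj v w ∧ s(v, w) ∈ H.1 := by
  constructor
  · rintro ⟨e, he, hv⟩
    obtain ⟨w, rfl⟩ := hv
    exact ⟨w, H.mem_edgeSet he, he⟩
  · rintro ⟨w, -, h⟩
    exact ⟨_, h, Sym2.mem_mk_left v w⟩

theorem left_mem_hypCarrier {H : Hyperplane X} {v w : V} (h : s(v, w) ∈ H.1) :
    v ∈ hypCarrier X H :=
  ⟨_, h, Sym2.mem_mk_left v w⟩

theorem right_mem_hypCarrier {H : Hyperplane X} {v w : V} (h : s(v, w) ∈ H.1) :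
    w ∈ hypCarrier X H :=
  ⟨_, h, Sym2.mem_mk_right v w⟩

theorem mem_of_square {H : Hyperplane X} {a b c d : V} (h : s(a, b) ∈ H.1) (hcd : X.Adj c d)
    (hac : X.Adj a c) (hbd : X.Adj b d) (had : a ≠ d) (hbc : b ≠ c) : s(c, d) ∈ H.1 :=
  H.mem_of_eqvGen h (.rel _ _ (Or.inr ⟨a, b, c, d, H.mem_edgeSet h, hcd, hac, hbd, had, hbc, rfl, rfl⟩))

theorem mem_of_triangle {H : Hyperplane X} {a b c : V} (h : s(a, b) ∈ H.1) (hac : X.Adj a c)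
    (hbc : X.Adj b c) : s(a, c) ∈ H.1 :=
  H.mem_of_eqvGen h (eqvGen_of_triangle (H.mem_edgeSet h) hac hbc)

theorem IsQuasiMedian.mem_of_inClique (hX : IsQuasiMedian X) {H : Hyperplane X} {a b c d : V}
    (h : s(a, b) ∈ H.1) (hc : InClique X a b c) (hd : InClique X a b d) (hcd : c ≠ d) :
    s(c, d) ∈ H.1 :=
  H.mem_of_eqvGen h (hX.eqvGen_of_inClique (H.mem_edgeSet h) hc hd hcd)

theorem IsQuasiMedian.hypCarrier_step (hX : IsQuasiMedian X) {H : Hyperplane X} {a a' s : V}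
    (ha : a ∈ hypCarrier X H) (hs : s ∈ hypCarrier X H) (haa' : X.Adj a a')
    (h : X.dist a' s + 1 = X.dist a s) : a' ∈ hypCarrier X H := by
  obtain ⟨b, hab, hb⟩ := mem_hypCarrier_iff.1 ha
  obtain ⟨t, hst, ht⟩ := mem_hypCarrier_iff.1 hs
  obtain ⟨c, d, hc, hd, hp⟩ := hX.cliqueParallel_of_eqvGen hab (H.eqvGen hb ht)
  by_cases hac : a = c
  · subst hac
    have had : s(a, d) ∈ H.1 := hX.mem_of_inClique hb hc hd hp.1.ne
    obtain ⟨d', h1, h2, h3, -, h4, -⟩ := hX.exists_rung hp haa' h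
    exact left_mem_hypCarrier (mem_of_square had h2 haa' h1 h3 h4)
  · have hac' : s(a, c) ∈ H.1 := hX.mem_of_inClique hb (inClique_left hab) hc hac
    by_cases hca : c = a'
    · exact hca ▸ right_mem_hypCarrier hac'
    · have h1 : Toward X c a s := hX.toward_of_inClique hab hc hd (inClique_left hab) hp.1.ne
        (Ne.symm hac) hp.toward_left
      unfold Toward at h1
      have c1 : X.dist s a = X.dist a s := SimpleGraph.dist_comm
      have c2 : X.dist s a' = X.dist a' s := SimpleGraph.dist_comm
      by_cases hadj : X.Adj c a'
      · exact right_mem_hypCarrier (mem_of_triangle hac' haa' hadj)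
      · have hadjac : X.Adj a c := H.mem_edgeSet hac'
        obtain ⟨u, hcu, hau, hu⟩ := hX.quadrangle hadjac haa' hca (x := s)
          (by omega) (by omega)
        have hne : a ≠ u := by
          rintro rfl
          omega
        exact left_mem_hypCarrier (mem_of_square hac' hau haa' hcu hne hca)

/-- Carriers are convex. -/
theorem IsQuasiMedian.isConvexSet_hypCarrier (hX : IsQuasiMedian X) (H : Hyperplane X) :
    IsConvexSet X (hypCarrier X H) := by
  have hc := hX.connected
  intro x hx y hy z h
  induction hn : X.dist x z generalizing x with
  | zero => exact hc.dist_eq_zero_iff.1 hn ▸ hx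
  | succ n ih =>
    have hxz : x ≠ z := by
      rintro rfl
      simp at hn
    obtain ⟨w, hxw, hw⟩ := exists_adj_dist_add_one hc hxz
    have t1 := hc.dist_triangle (u := w) (v := z) (w := y)
    have t2 := dist_le_dist_add_one hc hxw.symm y
    rw [SimpleGraph.dist_comm (u := y), SimpleGraph.dist_comm (u := y)] at t2
    exact ih w (hX.hypCarrier_step hx hy hxw (by omega)) (by omega) (by omega)

/-- A common neighbour of two adjacent vertices of a carrier lies in the carrier. -/
theorem IsQuasiMedian.hypCarrier_triangle (hX : IsQuasiMedian X) {H : Hyperplane X} {s s' w : V}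
    (hs : s ∈ hypCarrier X H) (hs' : s' ∈ hypCarrier X H) (hss' : X.Adj s s') (hsw : X.Adj s w)
    (hsw' : X.Adj s' w) : w ∈ hypCarrier X H := by
  have hc := hX.connected
  obtain ⟨t, hst, ht⟩ := mem_hypCarrier_iff.1 hs
  by_cases hwt : w = t
  · exact hwt ▸ right_mem_hypCarrier ht
  by_cases hadj : X.Adj t w
  · exact right_mem_hypCarrier (mem_of_triangle ht hsw hadj)
  obtain ⟨t', hst', ht'⟩ := mem_hypCarrier_iff.1 hs'
  obtain ⟨c, d, h1, h2, hp⟩ := hX.cliqueParallel_of_eqvGen hst (H.eqvGen ht ht')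
  have one := SimpleGraph.dist_eq_one_iff_adj.2 hss'
  by_cases hsc : s = c
  · subst hsc
    have hsd : s(s, d) ∈ H.1 := hX.mem_of_inClique ht h1 h2 hp.1.ne
    obtain ⟨-, -, h3, h4, h5⟩ := hp
    have hdt : X.Adj d t' := SimpleGraph.dist_eq_one_iff_adj.1 (by omega)
    by_cases hwd : w = d
    · exact hwd ▸ right_mem_hypCarrier hsd
    by_cases hdw : X.Adj d w
    · exact right_mem_hypCarrier (mem_of_triangle hsd hsw hdw)
    have e1 : X.dist w d = 2 := dist_eq_two hc hwd (fun h => hdw h.symm) hsw (H.mem_edgeSet hsd)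
    have hwt' : w ≠ t' := by
      rintro rfl
      exact hdw hdt
    have hnwt' : ¬ X.Adj w t' := by
      intro h
      have hns : s ≠ t' := by
        rintro rfl
        simp at h4
      have := SimpleGraph.dist_eq_one_iff_adj.2
        (hX.adj_of_common_edge hsw' hss'.symm hsw.symm hst' h hns)
      omega
    have e2 : X.dist w t' = 2 := dist_eq_two hc hwt' hnwt' hsw' hst'
    obtain ⟨u, hdu, htu, hu⟩ := hX.triangle hdt (x := w) (by omega)
    have hwu : X.Adj w u := SimpleGraph.dist_eq_one_iff_adj.1 (by omega)
    have hsu : s ≠ u := by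
      rintro rfl
      have := SimpleGraph.dist_eq_one_iff_adj.2 htu.symm
      omega
    exact left_mem_hypCarrier (mem_of_square hsd hwu hsw hdu hsu (Ne.symm hwd))
  · have hsc' : s(s, c) ∈ H.1 := hX.mem_of_inClique ht (inClique_left hst) h1 hsc
    have h3 : Toward X c s s' := hX.toward_of_inClique hst h1 h2 (inClique_left hst) hp.1.ne
      (Ne.symm hsc) hp.toward_left
    have : s' = c := by
      rw [← hc.dist_eq_zero_iff]
      unfold Toward at h3
      rw [SimpleGraph.dist_comm (u := s) (v := s')] at one
      omega
    subst this
    exact right_mem_hypCarrier (mem_of_triangle hsc' hsw hsw')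

/-- A nearest point of a carrier is a gate. -/
theorem IsQuasiMedian.dist_eq_of_nearest (hX : IsQuasiMedian X) {H : Hyperplane X} {x a s : V}
    (ha : a ∈ hypCarrier X H) (hmin : ∀ b ∈ hypCarrier X H, X.dist x a ≤ X.dist x b)
    (hs : s ∈ hypCarrier X H) : X.dist x s = X.dist x a + X.dist a s := by
  by_contra hne
  obtain ⟨u, v, hau, hav, huv, hu, hv⟩ := hX.exists_corner hne
  have hvH := hX.hypCarrier_step ha hs hav hv
  have huH : u ∈ hypCarrier X H := by
    rcases huv with rfl | huv
    · exact hvH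
    · exact hX.hypCarrier_triangle ha hvH hav hau huv.symm
  have := hmin u huH
  omega

/-- An edge of a carrier is dual to the hyperplane itself or to a hyperplane crossing it. -/
theorem IsQuasiMedian.eq_or_hypIntersect (hX : IsQuasiMedian X) {H D : Hyperplane X} {x y : V}
    (hx : x ∈ hypCarrier X H) (hy : y ∈ hypCarrier X H) (hD : s(x, y) ∈ D.1) :
    D = H ∨ HypIntersect X D H := by
  have hc := hX.connected
  have hxy : X.Adj x y := D.mem_edgeSet hD
  obtain ⟨b, hxb, hb⟩ := mem_hypCarrier_iff.1 hx
  obtain ⟨t, hyt, ht⟩ := mem_hypCarrier_iff.1 hy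
  obtain ⟨c, d, h1, h2, hp⟩ := hX.cliqueParallel_of_eqvGen hxb (H.eqvGen hb ht)
  have one := SimpleGraph.dist_eq_one_iff_adj.2 hxy
  by_cases hxc : x = c
  · subst hxc
    right
    have hxd : s(x, d) ∈ H.1 := hX.mem_of_inClique hb h1 h2 hp.1.ne
    obtain ⟨had, -, h3, h4, h5⟩ := hp
    refine ⟨x, _, hD, _, hxd, y, d, rfl, rfl, hxy, had, ?_, ?_, t, ?_, hyt,
      SimpleGraph.dist_eq_one_iff_adj.1 (by omega)⟩
    · rintro rfl
      simp at h5
    · intro h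
      have := SimpleGraph.dist_eq_one_iff_adj.2 h.symm
      omega
    · rintro rfl
      simp at h4
  · left
    have h3 : Toward X c x y := hX.toward_of_inClique hxb h1 h2 (inClique_left hxb) hp.1.ne
      (Ne.symm hxc) hp.toward_left
    have : y = c := by
      rw [← hc.dist_eq_zero_iff]
      unfold Toward at h3
      rw [SimpleGraph.dist_comm (u := x) (v := y)] at one
      omega
    subst this
    exact Hyperplane.eq_of_mem hD (hX.mem_of_inClique hb (inClique_left hxb) h1 hxc)

/-- A hyperplane crossing a geodesic from `x` to its gate `a` in a carrier has no edge in that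
carrier. -/
theorem IsQuasiMedian.not_mem_of_gate (hX : IsQuasiMedian X) {H D : Hyperplane X} {x a u s t : V}
    (hgate : ∀ s ∈ hypCarrier X H, X.dist x s = X.dist x a + X.dist a s)
    (hu : X.dist x u + 1 = X.dist x a) (hD : s(a, u) ∈ D.1)
    (hs : s ∈ hypCarrier X H) (ht : t ∈ hypCarrier X H) : s(s, t) ∉ D.1 := by
  have hc := hX.connected
  have hau : X.Adj a u := D.mem_edgeSet hD
  have key : ∀ s ∈ hypCarrier X H, Toward X a u s := by
    intro s hs
    have t1 := hc.dist_triangle (u := x) (v := u) (w := s)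
    have t2 := dist_le_dist_add_one hc hau s
    rw [hgate s hs, SimpleGraph.dist_comm (u := u), SimpleGraph.dist_comm (u := a)] at t1
    unfold Toward
    omega
  exact fun h => hX.not_eqvGen_of_toward hau (key s hs) (key t ht) (D.eqvGen hD h)

/-- If two vertices of a convex set lie on different sides of the edge `(a, b)`, then the set
contains an edge dual to the same hyperplane. -/
theorem IsQuasiMedian.exists_mem_of_convex (hX : IsQuasiMedian X) {D : Hyperplane X} {S : Set V}
    (hS : IsConvexSet X S) {a b x y : V} (hD : s(a, b) ∈ D.1) (hx : x ∈ S) (hy : y ∈ S)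
    (hxa : Toward X a b x) (hya : ¬ Toward X a b y) :
    ∃ u v, u ∈ S ∧ v ∈ S ∧ s(u, v) ∈ D.1 := by
  have hc := hX.connected
  induction hn : X.dist x y generalizing x with
  | zero => exact absurd (hc.dist_eq_zero_iff.1 hn ▸ hxa) hya
  | succ n ih =>
    have hxy : x ≠ y := by
      rintro rfl
      simp at hn
    obtain ⟨z, hxz, hz⟩ := exists_adj_dist_add_one hc hxy
    have one := SimpleGraph.dist_eq_one_iff_adj.2 hxz
    have hzS : z ∈ S := hS x hx y hy z (by omega)
    by_cases hza : Toward X a b z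
    · exact ih hzS hza (by omega)
    · exact ⟨x, z, hx, hzS,
        D.mem_of_eqvGen hD (hX.eqvGen_of_crossing (D.mem_edgeSet hD) hxz hxa hza)⟩

end Carriers

section Lifting

variable {V : Type*} {X : SimpleGraph V} {Y : SimpleGraph (Hyperplane X)}

theorem hypCarrier_inter_of_adj (hY : Y = contactGraph X ∨ Y = crossingGraph X)
    {H K : Hyperplane X} (h : Y.Adj H K) : ∃ p, p ∈ hypCarrier X H ∧ p ∈ hypCarrier X K := by
  have h1 : ∀ {H K : Hyperplane X}, HypIntersect X H K ∨ HypOsculate X H K →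
      ∃ p, p ∈ hypCarrier X H ∧ p ∈ hypCarrier X K := by
    rintro H K (⟨p, e, he, e', he', a, b, rfl, rfl, -⟩ | ⟨p, e, he, e', he', a, b, rfl, rfl, -⟩)
    · exact ⟨p, left_mem_hypCarrier he, left_mem_hypCarrier he'⟩
    · exact ⟨p, left_mem_hypCarrier he, left_mem_hypCarrier he'⟩
  have h2 : (HypIntersect X H K ∨ HypOsculate X H K) ∨
      (HypIntersect X K H ∨ HypOsculate X K H) := by
    rcases hY with rfl | rfl
    · exact h.2
    · exact h.2.imp Or.inl Or.inl
  rcases h2 with h2 | h2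
  · exact h1 h2
  · exact (h1 h2).imp fun _ => And.symm

theorem adj_of_hypIntersect (hY : Y = contactGraph X ∨ Y = crossingGraph X)
    {H K : Hyperplane X} (hne : H ≠ K) (h : HypIntersect X H K) : Y.Adj H K := by
  rcases hY with rfl | rfl
  · exact ⟨hne, Or.inl (Or.inl h)⟩
  · exact ⟨hne, Or.inl h⟩

theorem dist_sequence_le {H : ℕ → Hyperplane X} {m : ℕ}
    (h : ∀ i < m, Y.Adj (H i) (H (i + 1))) {i j : ℕ} (hij : i ≤ j) (hj : j ≤ m) :
    Y.Reachable (H i) (H j) ∧ Y.dist (H i) (H j) ≤ j - i := by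
  suffices ∃ w : Y.Walk (H i) (H j), w.length = j - i by
    obtain ⟨w, hw⟩ := this
    exact ⟨w.reachable, hw ▸ SimpleGraph.dist_le w⟩
  induction j, hij using Nat.le_induction with
  | base => exact ⟨.nil, by simp⟩
  | succ j hij ih =>
    obtain ⟨w, hw⟩ := ih (by omega)
    refine ⟨w.concat (h j (by omega)), ?_⟩
    rw [SimpleGraph.Walk.length_concat]
    omega

end Lifting

/-- **Proposition (lifting geodesics).** Let `Y` be the contact graph or the crossing graph
of a quasi-median graph `X`, let `A`, `B` be hyperplanes in the same connected component of
`Y`, and let `p ∈ N(A)`, `q ∈ N(B)`. Then there are a geodesic `A = A₀, …, A_m = B` in `Y`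
and vertices `p = p₀, …, p_{m+1} = q` of `X` with `p_i ∈ N(A_{i-1}) ∩ N(A_i)` for
`1 ≤ i ≤ m` and `d_X(p,q) = Σ_{i=0}^m d_X(p_i, p_{i+1})`. -/
theorem lift_geodesics {V : Type*} (X : SimpleGraph V) (hX : IsQuasiMedian X)
    (Y : SimpleGraph (Hyperplane X)) (hY : Y = contactGraph X ∨ Y = crossingGraph X)
    (A B : Hyperplane X) (hreach : Y.Reachable A B)
    (p q : V) (hp : p ∈ hypCarrier X A) (hq : q ∈ hypCarrier X B) :
    ∃ (m : ℕ) (Aseq : ℕ → Hyperplane X) (pseq : ℕ → V),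
      Aseq 0 = A ∧ Aseq m = B ∧ m = Y.dist A B ∧
      (∀ i < m, Y.Adj (Aseq i) (Aseq (i + 1))) ∧
      pseq 0 = p ∧ pseq (m + 1) = q ∧
      (∀ i, 1 ≤ i → i ≤ m →
        pseq i ∈ hypCarrier X (Aseq (i - 1)) ∧ pseq i ∈ hypCarrier X (Aseq i)) ∧
      X.dist p q = ∑ i ∈ Finset.range (m + 1), X.dist (pseq i) (pseq (i + 1)) := by
  have hc := hX.connected
  induction hm : Y.dist A B generalizing A p with
  | zero =>
    obtain rfl : A = B := hreach.dist_eq_zero_iff.1 hm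
    refine ⟨0, fun _ => A, fun | 0 => p | _ => q, rfl, rfl, rfl, ?_, rfl, rfl, ?_, ?_⟩
    · intro i hi
      omega
    · intro i hi hi'
      omega
    · simp
  | succ m ih =>
    let C : Hyperplane X × V → Prop := fun c =>
      Y.Adj A c.1 ∧ Y.Reachable c.1 B ∧ Y.dist c.1 B = m ∧ c.2 ∈ hypCarrier X c.1
    have hne : ∃ c, C c := by
      obtain ⟨w, hw⟩ := hreach.exists_walk_length_eq_dist
      cases w with
      | nil => simp at hm
      | cons h w =>
        rename_i K
        rw [SimpleGraph.Walk.length_cons] at hw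
        have h1 := SimpleGraph.dist_le w
        have h2 := SimpleGraph.dist_eq_one_iff_adj.2 h
        have h3 := h.reachable.dist_triangle_left B
        have h4 : Y.dist K B = m := by omega
        obtain ⟨r, -, hr⟩ := hypCarrier_inter_of_adj hY h
        exact ⟨(K, r), h, w.reachable, h4, hr⟩
    obtain ⟨⟨K, p'⟩, ⟨hAK, hKB, hKm, hp'⟩, hmin⟩ :=
      exists_minimalFor_of_wellFoundedLT C (fun c => X.dist p c.2) hne
    dsimp only at hAK hKB hKm hp' hmin
    have hnearest : ∀ b ∈ hypCarrier X K, X.dist p p' ≤ X.dist p b := by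
      intro b hb
      by_contra hlt
      exact hlt (hmin (j := (K, b)) ⟨hAK, hKB, hKm, hb⟩ (by dsimp only; omega))
    have hgate : ∀ s ∈ hypCarrier X K, X.dist p s = X.dist p p' + X.dist p' s :=
      fun s hs => hX.dist_eq_of_nearest hp' hnearest hs
    have hp'A : p' ∈ hypCarrier X A := by
      obtain ⟨r, hrA, hrK⟩ := hypCarrier_inter_of_adj hY hAK
      exact hX.isConvexSet_hypCarrier A p hp r hrA p' (hgate r hrK).symm
    obtain ⟨m', As, ps, hA0, hAm, hm', hadj, hp0, hpm, hcar, hsum⟩ := ih K hKB p' hp' hKm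
    subst hm'
    have hmem : ∀ i ≤ m', ps i ∈ hypCarrier X (As i) ∧ ps (i + 1) ∈ hypCarrier X (As i) := by
      intro i hi
      constructor
      · rcases Nat.eq_zero_or_pos i with rfl | h0
        · rw [hp0, hA0]
          exact hp'
        · exact (hcar i h0 hi).2
      · rcases hi.eq_or_lt with rfl | h0
        · rw [hpm, hAm]
          exact hq
        · exact (hcar (i + 1) (by omega) h0).1
    have hbetween : X.dist p q = X.dist p p' + X.dist p' q := by
      by_contra hne
      obtain ⟨u, v, hau, hav, huv, hu, hv⟩ := hX.exists_corner hne
      obtain ⟨D, hDu⟩ := exists_hyperplane hau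
      have hDv : s(p', v) ∈ D.1 := by
        rcases huv with rfl | huv
        · exact hDu
        · exact mem_of_triangle hDu hav huv
      have hcross : ∃ i ≤ m', Toward X p' v (ps i) ∧ ¬ Toward X p' v (ps (i + 1)) := by
        by_contra! H
        have hall : ∀ i ≤ m' + 1, Toward X p' v (ps i) := by
          intro i
          induction i with
          | zero =>
            intro _
            simp [Toward, hp0, hav]
          | succ i ih => exact fun hi => H i (by omega) (ih (by omega))
        have := hall _ le_rfl
        rw [hpm, Toward, SimpleGraph.dist_comm, SimpleGraph.dist_comm (u := q)] at this
        omega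
      obtain ⟨i, hi, ht, ht'⟩ := hcross
      obtain ⟨x, y, hx, hy, hxy⟩ := hX.exists_mem_of_convex (hX.isConvexSet_hypCarrier (As i)) hDv
        (hmem i hi).1 (hmem i hi).2 ht ht'
      have hDi := hX.eq_or_hypIntersect hx hy hxy
      have huA : u ∈ hypCarrier X A := hX.hypCarrier_step hp'A hp hau
        (by rw [SimpleGraph.dist_comm, hu, SimpleGraph.dist_comm])
      have hDA := hX.eq_or_hypIntersect hp'A huA hDu
      have hi0 : i ≠ 0 := by
        rintro rfl
        rw [hA0] at hx hy
        exact hX.not_mem_of_gate hgate hu hDu hx hy hxy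
      have near : ∀ {H}, D = H ∨ HypIntersect X D H → Y.Reachable D H ∧ Y.dist D H ≤ 1 := by
        intro H h
        by_cases hDH : D = H
        · subst hDH
          simp
        · have := adj_of_hypIntersect hY hDH (h.resolve_left hDH)
          exact ⟨this.reachable, (SimpleGraph.dist_eq_one_iff_adj.2 this).le⟩
      obtain ⟨r1, d1⟩ := near hDi
      obtain ⟨r2, d2⟩ := near hDA
      obtain ⟨r3, d3⟩ := dist_sequence_le hadj hi le_rfl
      rw [hAm] at r3 d3
      have t1 := r1.dist_triangle_left B
      have t2 := r2.symm.dist_triangle_left B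
      rw [SimpleGraph.dist_comm (u := A) (v := D)] at t2
      have hadjAD : Y.Adj A D := by
        rw [← SimpleGraph.dist_eq_one_iff_adj, SimpleGraph.dist_comm]
        omega
      have := hmin (j := (D, u)) ⟨hadjAD, r1.trans r3, by dsimp only; omega,
        right_mem_hypCarrier hDu⟩ (by dsimp only; omega)
      dsimp only at this
      omega
    refine ⟨m' + 1, fun | 0 => A | n + 1 => As n, fun | 0 => p | n + 1 => ps n, rfl, hAm, ?_, ?_,
      rfl, hpm, ?_, ?_⟩
    · omega
    · rintro (_ | i) hi
      · change Y.Adj A (As 0)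
        rw [hA0]
        exact hAK
      · exact hadj i (by omega)
    · rintro (_ | _ | i) hi hi'
      · omega
      · simp only [hp0, hA0]
        exact ⟨hp'A, hp'⟩
      · exact ⟨(hmem i (by omega)).2, (hmem (i + 1) (by omega)).1⟩
    · rw [Finset.sum_range_succ', hbetween, hsum, add_comm]
      change _ = ∑ k ∈ Finset.range (m' + 1), X.dist (ps k) (ps (k + 1)) + X.dist p (ps 0)
      rw [hp0]

end QM
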